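/- arXiv:2409.14251 — 3 statements merged into one kernel-verified Lean document; each statement's English description precedes it below -/
import Mathlib

section
/- Let (R, m) be a Noetherian local ring and let I and J be proper ideals of R. If a, b, r, s are positive integers such that m^a is contained in the integral closure of I^b and m^r is contained in the integral closure of J^s, then m^(sa+rb) is contained in the integral closure of (I·J)^(bs). -/
open Finset IsLocalRing

/-- The set of elements integral over an ideal `I`: `x` is integral over `I` if it satisfies
an equation `x ^ k + c 1 * x ^ (k-1) + ⋯ + c k = 0` with `c i ∈ I ^ i`. -/
def integralClosureIdeal {R : Type*} [CommRing R] (I : Ideal R) : Set R :=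
  {x | ∃ k : ℕ, 1 ≤ k ∧ ∃ c : ℕ → R, (∀ i, 1 ≤ i → i ≤ k → c i ∈ I ^ i) ∧
    x ^ k + ∑ i ∈ Finset.Icc 1 k, c i * x ^ (k - i) = 0}

open Polynomial in
/-- A root of a monic polynomial of positive degree whose coefficients lie in complementary
powers of `K` is integral over `K`. -/
theorem mem_integralClosureIdeal_of_monic {R : Type*} [CommRing R] {K : Ideal R} {z : R}
    {q : R[X]} (hq : q.Monic) (hd : 1 ≤ q.natDegree)
    (hc : ∀ j, q.coeff j ∈ K ^ (q.natDegree - j)) (h0 : q.eval z = 0) :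
    z ∈ integralClosureIdeal K := by
  refine ⟨q.natDegree, hd, fun i => q.coeff (q.natDegree - i), fun i _ hi => ?_, ?_⟩
  · simpa [Nat.sub_sub_self hi] using hc (q.natDegree - i)
  · rw [eval_eq_sum_range, sum_range_succ, hq.coeff_natDegree, one_mul, add_comm] at h0
    rw [← h0]
    congr 1
    refine sum_nbij' (q.natDegree - ·) (q.natDegree - ·) ?_ ?_ ?_ ?_ ?_ <;>
      simp only [mem_Icc, mem_range] <;> intros <;> first | rfl | lia

theorem Ideal.pow_add_succ_le_mul_pow {R : Type*} [CommRing R] {K L : Ideal R} {n : ℕ}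
    (h : L ^ (n + 1) ≤ K * L ^ n) (d : ℕ) :
    L ^ (n + d + 1) ≤ K * L ^ (n + d) := by
  calc L ^ (n + d + 1) = L ^ (n + 1) * L ^ d := by ring
    _ ≤ K * L ^ n * L ^ d := Ideal.mul_mono_left h
    _ = K * L ^ (n + d) := by ring

theorem Ideal.pow_add_le_pow_mul_pow {R : Type*} [CommRing R] {L M : Ideal R} {n m : ℕ}
    (h : M ^ (m + 1) ≤ L * M ^ m) :
    M ^ (m + n) ≤ L ^ n * M ^ m := by
  induction n with
  | zero => simp
  | succ n ih =>
    calc M ^ (m + (n + 1)) = M ^ (m + n) * M := by ring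
      _ ≤ L ^ n * M ^ m * M := Ideal.mul_mono_left ih
      _ = L ^ n * M ^ (m + 1) := by ring
      _ ≤ L ^ n * (L * M ^ m) := Ideal.mul_mono_right h
      _ = L ^ (n + 1) * M ^ m := by ring

/-- `K` is a reduction of `L`: it is contained in `L`, and `L ^ (n + 1) ≤ K * L ^ n` for
some `n`. -/
def Ideal.IsReductionOf {R : Type*} [CommRing R] (K L : Ideal R) : Prop :=
  K ≤ L ∧ ∃ n : ℕ, L ^ (n + 1) ≤ K * L ^ n

namespace Ideal.IsReductionOf

variable {R : Type*} [CommRing R] {K L M A B : Ideal R}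

theorem refl (K : Ideal R) : K.IsReductionOf K := ⟨le_rfl, 0, by simp⟩

theorem trans (h₁ : K.IsReductionOf L) (h₂ : L.IsReductionOf M) : K.IsReductionOf M := by
  obtain ⟨hKL, n, hn⟩ := h₁
  obtain ⟨hLM, m, hm⟩ := h₂
  refine ⟨hKL.trans hLM, m + n, ?_⟩
  calc M ^ (m + n + 1) = M ^ (m + (n + 1)) := by rw [add_assoc]
    _ ≤ L ^ (n + 1) * M ^ m := pow_add_le_pow_mul_pow hm
    _ ≤ K * L ^ n * M ^ m := Ideal.mul_mono_left hn
    _ ≤ K * M ^ n * M ^ m :=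
      Ideal.mul_mono_left (Ideal.mul_mono_right (Ideal.pow_right_mono hLM n))
    _ = K * M ^ (m + n) := by ring

theorem mul (h₁ : K.IsReductionOf L) (h₂ : A.IsReductionOf B) :
    (K * A).IsReductionOf (L * B) := by
  obtain ⟨hKL, n, hn⟩ := h₁
  obtain ⟨hAB, m, hm⟩ := h₂
  refine ⟨Ideal.mul_mono hKL hAB, n + m, ?_⟩
  calc (L * B) ^ (n + m + 1) = L ^ (n + m + 1) * B ^ (m + n + 1) := by ring
    _ ≤ (K * L ^ (n + m)) * (A * B ^ (m + n)) :=
      Ideal.mul_mono (pow_add_succ_le_mul_pow hn m) (pow_add_succ_le_mul_pow hm n)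
    _ = K * A * (L * B) ^ (n + m) := by ring

theorem pow (h : K.IsReductionOf L) (n : ℕ) : (K ^ n).IsReductionOf (L ^ n) := by
  induction n with
  | zero => simpa using refl (1 : Ideal R)
  | succ n ih => simpa only [pow_succ] using ih.mul h

theorem subset_integralClosureIdeal [IsNoetherianRing R] (h : K.IsReductionOf L) :
    (L : Set R) ⊆ integralClosureIdeal K := by
  obtain ⟨-, n, hn⟩ := h
  intro z hz
  have hzN : ∀ y ∈ L ^ n, z * y ∈ K * L ^ n := fun y hy =>
    hn (by rw [pow_succ']; exact Ideal.mul_mem_mul hz hy)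
  let f : Module.End R (L ^ n : Ideal R) := algebraMap R _ z
  have hf : LinearMap.range f ≤ K • ⊤ := by
    rintro _ ⟨y, rfl⟩
    rw [Submodule.mem_smul_top_iff]
    exact hzN y y.2
  obtain ⟨p, hp, -, hc, h0⟩ :=
    LinearMap.exists_monic_and_natDegree_eq_and_coeff_mem_pow_and_aeval_eq_zero R f K hf
  have hpz : p.eval z * z ^ n = 0 := by
    rw [Polynomial.aeval_algebraMap_apply] at h0
    simpa using congrArg Subtype.val (LinearMap.congr_fun h0 ⟨z ^ n, Ideal.pow_mem_pow hz n⟩)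
  cases subsingleton_or_nontrivial R
  · exact ⟨1, le_rfl, 0, fun i _ _ => zero_mem _, Subsingleton.elim _ _⟩
  have hdeg : (p * Polynomial.X ^ (n + 1)).natDegree = p.natDegree + (n + 1) := by
    rw [hp.natDegree_mul (Polynomial.monic_X_pow _), Polynomial.natDegree_X_pow]
  refine mem_integralClosureIdeal_of_monic (hp.mul (Polynomial.monic_X_pow (n + 1)))
    (by lia) (fun j => ?_) ?_
  · rw [hdeg, Polynomial.coeff_mul_X_pow']
    split_ifs with hj
    · convert hc (j - (n + 1)) using 2
      lia
    · exact zero_mem _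
  · rw [Polynomial.eval_mul, Polynomial.eval_pow, Polynomial.eval_X, pow_succ, ← mul_assoc, hpz,
      zero_mul]

end Ideal.IsReductionOf

section

variable {R : Type*} [CommRing R]

theorem integralClosureIdeal_mono {K L : Ideal R} (h : K ≤ L) :
    integralClosureIdeal K ⊆ integralClosureIdeal L := by
  rintro x ⟨k, hk, c, hc, hx⟩
  exact ⟨k, hk, c, fun i hi hik => Ideal.pow_right_mono h i (hc i hi hik), hx⟩

theorem Ideal.sup_span_singleton_pow_succ_le (K : Ideal R) (x : R) (n : ℕ) :
    (K ⊔ Ideal.span {x}) ^ (n + 1) ≤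
      K * (K ⊔ Ideal.span {x}) ^ n ⊔ Ideal.span {x ^ (n + 1)} := by
  set L := K ⊔ Ideal.span {x} with hL
  induction n with
  | zero => simp [hL]
  | succ n ih =>
    have hx : Ideal.span {x} ≤ L := le_sup_right
    calc L ^ (n + 1 + 1) = K * L ^ (n + 1) ⊔ Ideal.span {x} * L ^ (n + 1) := by
          rw [pow_succ' L (n + 1)]; nth_rewrite 1 [hL]; rw [Ideal.sup_mul]
      _ ≤ K * L ^ (n + 1) ⊔ Ideal.span {x} * (K * L ^ n ⊔ Ideal.span {x ^ (n + 1)}) :=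
          sup_le_sup_left (Ideal.mul_mono_right ih) _
      _ ≤ _ := by
          rw [Ideal.mul_sup, Ideal.span_singleton_mul_span_singleton, ← pow_succ']
          refine sup_le le_sup_left (sup_le (le_sup_of_le_left ?_) le_sup_right)
          calc Ideal.span {x} * (K * L ^ n) ≤ L * (K * L ^ n) := Ideal.mul_mono_left hx
            _ = K * L ^ (n + 1) := by ring

theorem Ideal.isReductionOf_sup_span_singleton {K : Ideal R} {x : R}
    (hx : x ∈ integralClosureIdeal K) : K.IsReductionOf (K ⊔ Ideal.span {x}) := by
  obtain ⟨k, hk, c, hc, h0⟩ := hx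
  obtain ⟨n, rfl⟩ := Nat.exists_eq_add_of_le' hk
  refine ⟨le_sup_left, n, (Ideal.sup_span_singleton_pow_succ_le K x n).trans
    (sup_le le_rfl ?_)⟩
  rw [Ideal.span_singleton_le_iff_mem, eq_neg_of_add_eq_zero_left h0]
  refine NegMemClass.neg_mem (_root_.sum_mem fun i hi => ?_)
  obtain ⟨hi1, hik⟩ := Finset.mem_Icc.mp hi
  obtain ⟨j, rfl⟩ := Nat.exists_eq_add_of_le' hi1
  have hxL : x ∈ K ⊔ Ideal.span {x} :=
    Ideal.mem_sup_right (Ideal.mem_span_singleton_self x)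
  have hle : K ^ (j + 1) * (K ⊔ Ideal.span {x}) ^ (n + 1 - (j + 1)) ≤
      K * (K ⊔ Ideal.span {x}) ^ n := by
    calc _ = K * (K ^ j * (K ⊔ Ideal.span {x}) ^ (n - j)) := by
          rw [Nat.add_sub_add_right]; ring
      _ ≤ K * ((K ⊔ Ideal.span {x}) ^ j * (K ⊔ Ideal.span {x}) ^ (n - j)) := by
          gcongr; exact le_sup_left
      _ = _ := by rw [← pow_add, Nat.add_sub_cancel' (by lia)]
  exact hle (Ideal.mul_mem_mul (hc _ hi1 hik) (Ideal.pow_mem_pow hxL _))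

theorem Ideal.FG.isReductionOf_sup {K P : Ideal R} (hP : P.FG)
    (h : (P : Set R) ⊆ integralClosureIdeal K) : K.IsReductionOf (K ⊔ P) := by
  classical
  obtain ⟨S, rfl⟩ := hP
  have hS : (S : Set R) ⊆ integralClosureIdeal K := Submodule.subset_span.trans h
  clear h
  induction S using Finset.induction_on with
  | empty => simpa using IsReductionOf.refl K
  | insert x S _ ih =>
    rw [Finset.coe_insert, Set.insert_subset_iff] at hS
    have hx := Ideal.isReductionOf_sup_span_singleton
      (integralClosureIdeal_mono (le_sup_left (b := Ideal.span (S : Set R))) hS.1)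
    have := (ih hS.2).trans hx
    rwa [sup_assoc, sup_comm (Ideal.span (S : Set R)), ← Ideal.span_insert,
      ← Finset.coe_insert] at this

end

theorem maximalIdeal_pow_subset_integralClosure_mul
    {R : Type*} [CommRing R] [IsNoetherianRing R] [IsLocalRing R]
    (I J : Ideal R) (hI : I ≠ ⊤) (hJ : J ≠ ⊤) (a b r s : ℕ)
    (ha : 0 < a) (hb : 0 < b) (hr : 0 < r) (hs : 0 < s)
    (h1 : ((maximalIdeal R ^ a : Ideal R) : Set R) ⊆ integralClosureIdeal (I ^ b))
    (h2 : ((maximalIdeal R ^ r : Ideal R) : Set R) ⊆ integralClosureIdeal (J ^ s)) :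
    ((maximalIdeal R ^ (s * a + r * b) : Ideal R) : Set R) ⊆
      integralClosureIdeal ((I * J) ^ (b * s)) := by
  have hred := ((Ideal.FG.isReductionOf_sup (IsNoetherian.noetherian _) h1).pow s).mul
    ((Ideal.FG.isReductionOf_sup (IsNoetherian.noetherian _) h2).pow b)
  have hK : (I ^ b) ^ s * (J ^ s) ^ b = (I * J) ^ (b * s) := by ring
  rw [hK] at hred
  refine subset_trans ?_ hred.subset_integralClosureIdeal
  rw [pow_add, mul_comm s a, pow_mul, pow_mul]
  exact Ideal.mul_mono (Ideal.pow_right_mono le_sup_right s)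
    (Ideal.pow_right_mono le_sup_right b)
end

section
/- Let (R, m) be a Noetherian local ring and let I_1, …, I_r be proper ideals of R, each having finite Łojasiewicz exponent. Then the product I_1·I_2⋯I_r has finite Łojasiewicz exponent and 𝓛₀(I_1⋯I_r) ≤ 𝓛₀(I_1) + ⋯ + 𝓛₀(I_r). -/
open Finset IsLocalRing

/-- `Λ(I)`: the set of rationals `r/s` (as real numbers) with `r, s` positive integers such that
`m ^ r` is contained in the integral closure of `I ^ s`. -/
def Lambda (R : Type*) [CommRing R] [IsLocalRing R] (I : Ideal R) : Set ℝ :=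
  {x | ∃ r s : ℕ, 0 < r ∧ 0 < s ∧
    ((maximalIdeal R ^ r : Ideal R) : Set R) ⊆ integralClosureIdeal (I ^ s) ∧
    x = (r : ℝ) / (s : ℝ)}

/-- The Łojasiewicz exponent `𝓛₀(I)`, the infimum of `Λ(I)`. -/
noncomputable def Loj (R : Type*) [CommRing R] [IsLocalRing R] (I : Ideal R) : ℝ :=
  sInf (Lambda R I)

namespace Ideal

variable {R : Type*} [CommRing R]

/-- Some power of `K` satisfies `K ^ (n + 1) ≤ I * K ^ n`, so that `I` is a reduction of `K`
(up to the inclusion `I ≤ K`, which is not required). -/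
def Reduces (I K : Ideal R) : Prop :=
  ∃ n : ℕ, K ^ (n + 1) ≤ I * K ^ n

lemma pow_succ_le_mul_pow_of_le {I K : Ideal R} {n N : ℕ} (h : K ^ (n + 1) ≤ I * K ^ n)
    (hN : n ≤ N) : K ^ (N + 1) ≤ I * K ^ N := by
  obtain ⟨m, rfl⟩ := Nat.exists_eq_add_of_le hN
  calc K ^ (n + m + 1) = K ^ (n + 1) * K ^ m := by ring
    _ ≤ I * K ^ n * K ^ m := Ideal.mul_mono_left h
    _ = I * K ^ (n + m) := by ring

lemma Reduces.one : Reduces (1 : Ideal R) 1 := ⟨0, by simp⟩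

lemma Reduces.mul {I J K L : Ideal R} (hK : Reduces I K) (hL : Reduces J L) :
    Reduces (I * J) (K * L) := by
  obtain ⟨n, hn⟩ := hK
  obtain ⟨m, hm⟩ := hL
  refine ⟨max n m, ?_⟩
  rw [mul_pow, mul_pow, mul_mul_mul_comm]
  exact Ideal.mul_mono (pow_succ_le_mul_pow_of_le hn (le_max_left _ _))
    (pow_succ_le_mul_pow_of_le hm (le_max_right _ _))

lemma Reduces.prod {ι : Type*} (s : Finset ι) {I K : ι → Ideal R}
    (h : ∀ i ∈ s, Reduces (I i) (K i)) : Reduces (∏ i ∈ s, I i) (∏ i ∈ s, K i) := by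
  classical
  induction s using Finset.induction_on with
  | empty => simpa using Reduces.one
  | insert a s ha ih =>
    rw [Finset.prod_insert ha, Finset.prod_insert ha]
    exact (h a (by simp)).mul (ih fun i hi => h i (by simp [hi]))

lemma sup_pow_le {K L T : Ideal R} {N : ℕ} (h : ∀ i j, i + j = N → K ^ i * L ^ j ≤ T) :
    (K ⊔ L) ^ N ≤ T := by
  rw [← Submodule.add_eq_sup, add_pow, Ideal.sum_eq_sup]
  refine Finset.sup_le fun i hi => Ideal.mul_le_left.trans (h i (N - i) ?_)
  have := Finset.mem_range.mp hi
  omega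

lemma pow_mul_pow_le_sup_pow (K L : Ideal R) (i j : ℕ) : K ^ i * L ^ j ≤ (K ⊔ L) ^ (i + j) := by
  rw [pow_add]
  exact Ideal.mul_mono (Ideal.pow_right_mono le_sup_left _) (Ideal.pow_right_mono le_sup_right _)

lemma Reduces.sup {I K L : Ideal R} (hK : Reduces I K) (hL : Reduces I L) :
    Reduces I (K ⊔ L) := by
  obtain ⟨n, hn⟩ := hK
  obtain ⟨m, hm⟩ := hL
  refine ⟨n + m, sup_pow_le fun i j hij => ?_⟩
  rcases lt_or_ge n i with hi | hi
  · obtain ⟨i, rfl⟩ : ∃ i', i = i' + 1 := ⟨i - 1, by omega⟩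
    calc K ^ (i + 1) * L ^ j ≤ I * K ^ i * L ^ j :=
          Ideal.mul_mono_left (pow_succ_le_mul_pow_of_le hn (by omega))
      _ = I * (K ^ i * L ^ j) := mul_assoc _ _ _
      _ ≤ I * (K ⊔ L) ^ (i + j) := Ideal.mul_mono_right (pow_mul_pow_le_sup_pow _ _ _ _)
      _ = I * (K ⊔ L) ^ (n + m) := by rw [show i + j = n + m by omega]
  · obtain ⟨j, rfl⟩ : ∃ j', j = j' + 1 := ⟨j - 1, by omega⟩
    calc K ^ i * L ^ (j + 1) ≤ K ^ i * (I * L ^ j) :=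
          Ideal.mul_mono_right (pow_succ_le_mul_pow_of_le hm (by omega))
      _ = I * (K ^ i * L ^ j) := mul_left_comm _ _ _
      _ ≤ I * (K ⊔ L) ^ (i + j) := Ideal.mul_mono_right (pow_mul_pow_le_sup_pow _ _ _ _)
      _ = I * (K ⊔ L) ^ (n + m) := by rw [show i + j = n + m by omega]

lemma reduces_sup_span_singleton {I : Ideal R} {x : R} (hx : x ∈ integralClosureIdeal I) :
    Reduces I (I ⊔ span {x}) := by
  obtain ⟨k, hk, c, hc, h⟩ := hx
  obtain ⟨n, rfl⟩ : ∃ n, k = n + 1 := ⟨k - 1, by omega⟩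
  have key : ∀ i j, i + j = n →
      I ^ (i + 1) * span {x} ^ j ≤ I * (I ⊔ span {x}) ^ n := by
    rintro i j rfl
    rw [pow_succ', mul_assoc]
    exact Ideal.mul_mono_right (pow_mul_pow_le_sup_pow _ _ _ _)
  refine ⟨n, sup_pow_le fun i j hij => ?_⟩
  rcases i with _ | i
  · obtain rfl : j = n + 1 := by omega
    rw [pow_zero, one_mul, span_singleton_pow, span_singleton_le_iff_mem,
      eq_neg_of_add_eq_zero_left h]
    refine neg_mem (Ideal.sum_mem _ fun i hi => ?_)
    obtain ⟨hi1, hi2⟩ := Finset.mem_Icc.mp hi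
    obtain ⟨i, rfl⟩ : ∃ i', i = i' + 1 := ⟨i - 1, by omega⟩
    exact key i (n + 1 - (i + 1)) (by omega) (Ideal.mul_mem_mul (hc _ hi1 hi2)
      (Ideal.pow_mem_pow (mem_span_singleton_self x) _))
  · exact key i j (by omega)

lemma exists_le_reduces [IsNoetherianRing R] {I A : Ideal R}
    (hA : (A : Set R) ⊆ integralClosureIdeal I) : ∃ K, A ≤ K ∧ Reduces I K := by
  have hfg : A.FG := IsNoetherian.noetherian A
  induction A, hfg using Submodule.fg_induction with
  | singleton x =>
    exact ⟨I ⊔ span {x}, le_sup_right,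
      reduces_sup_span_singleton (hA (Submodule.mem_span_singleton_self x))⟩
  | sup B C _ _ hB hC =>
    obtain ⟨K, hBK, hK⟩ := hB fun y hy => hA (Submodule.mem_sup_left hy)
    obtain ⟨L, hCL, hL⟩ := hC fun y hy => hA (Submodule.mem_sup_right hy)
    exact ⟨K ⊔ L, sup_le_sup hBK hCL, hK.sup hL⟩

open Polynomial in
lemma mem_integralClosureIdeal_of_monic {I : Ideal R} {x : R} {p : R[X]} (hp : p.Monic)
    (hd : 1 ≤ p.natDegree) (hc : ∀ k, p.coeff k ∈ I ^ (p.natDegree - k)) (h : p.eval x = 0) :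
    x ∈ integralClosureIdeal I := by
  refine ⟨p.natDegree, hd, fun i => p.coeff (p.natDegree - i), fun i _ hi => ?_, ?_⟩
  · simpa [Nat.sub_sub_self hi] using hc (p.natDegree - i)
  · rw [eval_eq_sum_range, ← Finset.sum_range_reflect, Finset.sum_range_succ'] at h
    rw [← h, add_comm, ← Finset.Ico_add_one_right_eq_Icc, Finset.sum_Ico_eq_sum_range]
    congr 1
    · refine Finset.sum_congr rfl fun i _ => ?_
      simp [add_comm]
    · simp [hp.coeff_natDegree]

open Polynomial in
lemma Reduces.subset_integralClosureIdeal [IsNoetherianRing R] [Nontrivial R] {I K : Ideal R}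
    (h : Reduces I K) : (K : Set R) ⊆ integralClosureIdeal I := by
  intro x hx
  obtain ⟨n, hn⟩ := h
  obtain ⟨p, hp, -, hc, h0⟩ :=
    LinearMap.exists_monic_and_natDegree_eq_and_coeff_mem_pow_and_aeval_eq_zero R
      (algebraMap R (Module.End R (K ^ n : Ideal R)) x) I (by
        rintro _ ⟨y, rfl⟩
        rw [Submodule.mem_smul_top_iff]
        refine hn ?_
        rw [pow_succ']
        exact Ideal.mul_mem_mul hx y.2)
  rw [aeval_algebraMap_apply] at h0
  have h1 := congrArg Subtype.val
    (LinearMap.congr_fun h0 ⟨x ^ n, Ideal.pow_mem_pow hx n⟩)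
  have h2 : p.eval x * x ^ n = 0 := by simpa [Module.algebraMap_end_apply] using h1
  have hdeg : (p * X ^ (n + 1)).natDegree = p.natDegree + (n + 1) := by
    rw [hp.natDegree_mul (monic_X_pow _), natDegree_X_pow]
  refine mem_integralClosureIdeal_of_monic (hp.mul (monic_X_pow (n + 1))) (by omega)
    (fun k => ?_) ?_
  · rw [hdeg, coeff_mul_X_pow']
    split_ifs with hk
    · simpa [show p.natDegree + (n + 1) - k = p.natDegree - (k - (n + 1)) by omega] using hc _
    · exact zero_mem _
  · rw [eval_mul, eval_pow, eval_X, pow_succ, ← mul_assoc, h2, zero_mul]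

lemma prod_subset_integralClosureIdeal [IsNoetherianRing R] [Nontrivial R] {ι : Type*}
    (s : Finset ι) {A I : ι → Ideal R}
    (h : ∀ i ∈ s, (A i : Set R) ⊆ integralClosureIdeal (I i)) :
    ((∏ i ∈ s, A i : Ideal R) : Set R) ⊆ integralClosureIdeal (∏ i ∈ s, I i) := by
  have h' : ∀ i, ∃ K, i ∈ s → A i ≤ K ∧ Reduces (I i) K := fun i => by
    by_cases hi : i ∈ s
    · obtain ⟨K, hK⟩ := exists_le_reduces (h i hi)
      exact ⟨K, fun _ => hK⟩
    · exact ⟨⊥, fun hi' => absurd hi' hi⟩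
  choose K hK using h'
  have hle : ∏ i ∈ s, A i ≤ ∏ i ∈ s, K i := Finset.prod_le_prod' fun i hi => (hK i hi).1
  exact subset_trans hle (Reduces.prod s fun i hi => (hK i hi).2).subset_integralClosureIdeal

lemma pow_subset_integralClosureIdeal_pow [IsNoetherianRing R] [Nontrivial R]
    {A I : Ideal R} (h : (A : Set R) ⊆ integralClosureIdeal I) (n : ℕ) :
    ((A ^ n : Ideal R) : Set R) ⊆ integralClosureIdeal (I ^ n) := by
  simpa using prod_subset_integralClosureIdeal (Finset.range n) fun _ _ => h

end Ideal

section Lojasiewicz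

variable {R : Type*} [CommRing R] [IsLocalRing R]

lemma sum_mem_Lambda_prod [IsNoetherianRing R] {ι : Type*} [Fintype ι] [Nonempty ι]
    {I : ι → Ideal R} {x : ι → ℝ} (hx : ∀ i, x i ∈ Lambda R (I i)) :
    ∑ i, x i ∈ Lambda R (∏ i, I i) := by
  classical
  choose a b ha hb hab hx using hx
  let t : ι → ℕ := fun i => ∏ j ∈ Finset.univ.erase i, b j
  have ht : ∀ i, b i * t i = ∏ j, b j := fun i =>
    Finset.mul_prod_erase _ _ (Finset.mem_univ i)
  have ht0 : ∀ i, 0 < t i := fun i => Finset.prod_pos fun j _ => hb j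
  refine ⟨∑ i, a i * t i, ∏ j, b j, ?_, Finset.prod_pos fun j _ => hb j, ?_, ?_⟩
  · exact Finset.sum_pos (fun i _ => Nat.mul_pos (ha i) (ht0 i)) Finset.univ_nonempty
  · rw [← Finset.prod_pow_eq_pow_sum, ← Finset.prod_pow]
    refine Ideal.prod_subset_integralClosureIdeal _ fun i _ => ?_
    rw [← ht i, pow_mul, pow_mul]
    exact Ideal.pow_subset_integralClosureIdeal_pow (hab i) _
  · push_cast
    rw [Finset.sum_div]
    refine Finset.sum_congr rfl fun i _ => ?_
    have h1 : (∏ j, (b j : ℝ)) = b i * t i := by exact_mod_cast (ht i).symm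
    have h2 : (t i : ℝ) ≠ 0 := by exact_mod_cast (ht0 i).ne'
    rw [hx i, h1, mul_div_mul_right _ _ h2]

lemma bddBelow_Lambda (I : Ideal R) : BddBelow (Lambda R I) := by
  refine ⟨0, ?_⟩
  rintro _ ⟨r, s, -, -, -, rfl⟩
  positivity

end Lojasiewicz

theorem loj_prod_le_sum
    {R : Type*} [CommRing R] [IsNoetherianRing R] [IsLocalRing R]
    (r : ℕ) (hr : 0 < r) (I : Fin r → Ideal R) (hI : ∀ i, I i ≠ ⊤)
    (hfin : ∀ i, (Lambda R (I i)).Nonempty) :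
    (Lambda R (∏ i, I i)).Nonempty ∧ Loj R (∏ i, I i) ≤ ∑ i, Loj R (I i) := by
  have : Nonempty (Fin r) := ⟨⟨0, hr⟩⟩
  have hr' : (0 : ℝ) < r := by exact_mod_cast hr
  constructor
  · choose x hx using hfin
    exact ⟨_, sum_mem_Lambda_prod hx⟩
  · refine le_of_forall_pos_le_add fun ε hε => ?_
    have h : ∀ i, ∃ x ∈ Lambda R (I i), x < Loj R (I i) + ε / r := fun i =>
      exists_lt_of_csInf_lt (hfin i) (lt_add_of_pos_right _ (div_pos hε hr'))
    choose x hx hlt using h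
    calc Loj R (∏ i, I i) ≤ ∑ i, x i := csInf_le (bddBelow_Lambda _) (sum_mem_Lambda_prod hx)
      _ ≤ ∑ i, (Loj R (I i) + ε / r) := Finset.sum_le_sum fun i _ => (hlt i).le
      _ = ∑ i, Loj R (I i) + ε := by
        rw [Finset.sum_add_distrib]
        simp [mul_div_cancel₀ _ hr'.ne']
end

section
/- Let (R, m) be a Noetherian local ring and let I and J be proper ideals of R with finite Łojasiewicz exponents. If I and J are projectively equivalent, i.e. there exist positive integers a, b such that the integral closure of I^a equals the integral closure of J^b, then 𝓛₀(I·J) = 𝓛₀(I) + 𝓛₀(J). -/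
open Finset IsLocalRing

open scoped Pointwise

namespace Ideal

variable {R : Type*} [CommRing R] {I J K : Ideal R} {x y : R}

theorem isIntegral_monomial_of_mem_integralClosureIdeal (hx : x ∈ integralClosureIdeal I) :
    IsIntegral (reesAlgebra I) (Polynomial.monomial 1 x) := by
  obtain ⟨k, hk, c, hc, h⟩ := hx
  let d : ℕ → reesAlgebra I := fun i =>
    if hi : i ∈ Finset.Icc 1 k then
      ⟨Polynomial.monomial i (c i), reesAlgebra.monomial_mem.2
        (hc i (Finset.mem_Icc.1 hi).1 (Finset.mem_Icc.1 hi).2)⟩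
    else 0
  refine ⟨Polynomial.X ^ k + ∑ i ∈ Finset.Icc 1 k, Polynomial.C (d i) * Polynomial.X ^ (k - i),
    Polynomial.monic_X_pow_add ?_, ?_⟩
  · refine (Polynomial.degree_sum_le _ _).trans_lt ?_
    refine (Finset.sup_lt_iff (WithBot.bot_lt_coe k)).2 fun i hi => ?_
    refine (Polynomial.degree_C_mul_X_pow_le _ _).trans_lt ?_
    have := Finset.mem_Icc.1 hi
    exact WithBot.coe_lt_coe.2 (by omega : k - i < k)
  · rw [Polynomial.eval₂_add, Polynomial.eval₂_finsetSum, Polynomial.eval₂_X_pow]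
    have : ∀ i ∈ Finset.Icc 1 k,
        Polynomial.eval₂ (algebraMap (reesAlgebra I) (Polynomial R)) (Polynomial.monomial 1 x)
          (Polynomial.C (d i) * Polynomial.X ^ (k - i)) =
        Polynomial.monomial k (c i * x ^ (k - i)) := by
      intro i hi
      have hik := Finset.mem_Icc.1 hi
      have hd : algebraMap (reesAlgebra I) (Polynomial R) (d i) = Polynomial.monomial i (c i) := by
        simp only [d, dif_pos hi]
        rfl
      rw [Polynomial.eval₂_mul, Polynomial.eval₂_C, Polynomial.eval₂_X_pow, hd,
        Polynomial.monomial_pow, Polynomial.monomial_mul_monomial, one_mul,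
        Nat.add_sub_cancel' hik.2]
    rw [Finset.sum_congr rfl this, ← map_sum, Polynomial.monomial_pow, one_mul, ← map_add, h,
      map_zero]

theorem mem_integralClosureIdeal_of_isIntegral_monomial
    (hx : IsIntegral (reesAlgebra I) (Polynomial.monomial 1 x)) :
    x ∈ integralClosureIdeal I := by
  cases subsingleton_or_nontrivial R
  · exact ⟨1, le_rfl, 0, fun i _ _ => zero_mem _, Subsingleton.elim _ _⟩
  obtain ⟨p, hp, h⟩ := hx
  set n := p.natDegree with hn
  have hn1 : 1 ≤ n := by
    rw [Nat.one_le_iff_ne_zero]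
    intro h0
    rw [hp.natDegree_eq_zero.1 (hn.symm.trans h0), Polynomial.eval₂_one] at h
    exact one_ne_zero h
  refine ⟨n, hn1, fun i => (p.coeff (n - i) : Polynomial R).coeff i,
    fun i _ _ => (p.coeff (n - i)).2 i, ?_⟩
  have h' := congrArg (fun q : Polynomial R => q.coeff n) h
  simp only [Polynomial.coeff_zero, Polynomial.eval₂_eq_sum_range, ← hn,
    Polynomial.finsetSum_coeff] at h'
  have key : ∀ j ∈ Finset.range (n + 1),
      (algebraMap (reesAlgebra I) (Polynomial R) (p.coeff j) *
        Polynomial.monomial 1 x ^ j).coeff n =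
      (p.coeff j : Polynomial R).coeff (n - j) * x ^ j := by
    intro j hj
    have hjn : j ≤ n := Nat.lt_succ_iff.1 (Finset.mem_range.1 hj)
    rw [Polynomial.monomial_pow, one_mul]
    conv_lhs => rw [← Nat.sub_add_cancel hjn]
    rw [Polynomial.coeff_mul_monomial]
    rfl
  rw [Finset.sum_congr rfl key, ← Finset.sum_range_reflect, Finset.sum_range_succ'] at h'
  have hlead : (p.coeff n) = 1 := hp.coeff_natDegree
  rw [← h', add_comm]
  congr 1
  · rw [← Finset.Ico_add_one_right_eq_Icc, Finset.sum_Ico_eq_sum_range]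
    refine Finset.sum_congr (by simp) fun i hi => ?_
    have hi' := Finset.mem_range.1 hi
    rw [show n + 1 - 1 - (i + 1) = n - (1 + i) by omega,
      show n - (n - (1 + i)) = 1 + i by omega]
  · simp [hlead]

/-- The integral closure of an ideal, as an ideal. -/
def integralClosure (I : Ideal R) : Ideal R where
  carrier := integralClosureIdeal I
  zero_mem' := mem_integralClosureIdeal_of_isIntegral_monomial <| by
    rw [map_zero]; exact isIntegral_zero
  add_mem' ha hb := mem_integralClosureIdeal_of_isIntegral_monomial <| by
    rw [map_add]
    exact (isIntegral_monomial_of_mem_integralClosureIdeal ha).add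
      (isIntegral_monomial_of_mem_integralClosureIdeal hb)
  smul_mem' r a ha := mem_integralClosureIdeal_of_isIntegral_monomial <| by
    rw [← Polynomial.smul_monomial]
    exact (isIntegral_monomial_of_mem_integralClosureIdeal ha).smul r

theorem mem_integralClosure : x ∈ I.integralClosure ↔ x ∈ integralClosureIdeal I := Iff.rfl

theorem mem_integralClosure_iff_isIntegral :
    x ∈ I.integralClosure ↔ IsIntegral (reesAlgebra I) (Polynomial.monomial 1 x) :=
  ⟨isIntegral_monomial_of_mem_integralClosureIdeal,
    mem_integralClosureIdeal_of_isIntegral_monomial⟩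

theorem le_integralClosure : I ≤ I.integralClosure := fun x hx =>
  ⟨1, le_rfl, fun _ => -x, fun i h1 h2 => by
    rw [le_antisymm h2 h1, pow_one]; exact neg_mem hx, by simp⟩

theorem integralClosure_le_integralClosure (h : I ≤ J.integralClosure) :
    I.integralClosure ≤ J.integralClosure := by
  intro x hx
  rw [mem_integralClosure_iff_isIntegral] at hx ⊢
  have hle : reesAlgebra I ≤
      (_root_.integralClosure (reesAlgebra J) (Polynomial R)).restrictScalars R := by
    rw [← adjoin_monomial_eq_reesAlgebra, Algebra.adjoin_le_iff]
    rintro _ ⟨y, hy, rfl⟩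
    exact mem_integralClosure_iff_isIntegral.1 (h hy)
  have hx' : IsIntegral (_root_.integralClosure (reesAlgebra J) (Polynomial R))
      (Polynomial.monomial 1 x) := by
    obtain ⟨p, hp, h0⟩ := hx
    refine ⟨p.map ((algebraMap (reesAlgebra I) (Polynomial R)).codRestrict
      (_root_.integralClosure (reesAlgebra J) (Polynomial R)) fun z => hle z.2), hp.map _, ?_⟩
    rw [Polynomial.eval₂_map]
    exact h0
  exact isIntegral_trans _ hx'

theorem mul_mem_integralClosure_mul_of_mem (hx : x ∈ I) (hy : y ∈ J.integralClosure) :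
    x * y ∈ (I * J).integralClosure := by
  obtain ⟨k, hk, c, hc, h⟩ := hy
  refine ⟨k, hk, fun i => x ^ i * c i, fun i h1 h2 => ?_, ?_⟩
  · rw [mul_pow]
    exact mul_mem_mul (pow_mem_pow hx i) (hc i h1 h2)
  · rw [← mul_zero (x ^ k), ← h, mul_add, mul_pow, Finset.mul_sum]
    congr 1
    refine Finset.sum_congr rfl fun i hi => ?_
    rw [← Nat.add_sub_cancel' (Finset.mem_Icc.1 hi).2, pow_add x, Nat.add_sub_cancel_left]
    ring

theorem mul_integralClosure_le : I * J.integralClosure ≤ (I * J).integralClosure :=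
  mul_le.2 fun _ hx _ hy => mul_mem_integralClosure_mul_of_mem hx hy

theorem integralClosure_mul_le :
    I.integralClosure * J.integralClosure ≤ (I * J).integralClosure := by
  rw [mul_comm]
  refine mul_integralClosure_le.trans (integralClosure_le_integralClosure ?_)
  rw [mul_comm]
  exact mul_integralClosure_le

theorem integralClosure_pow_le (n : ℕ) :
    I.integralClosure ^ n ≤ (I ^ n).integralClosure := by
  induction n with
  | zero => simpa using le_integralClosure (I := (1 : Ideal R))
  | succ n ih =>
    rw [pow_succ, pow_succ]
    exact (mul_mono_left ih).trans integralClosure_mul_le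

theorem integralClosure_mul_congr {I' J' : Ideal R}
    (hI : I.integralClosure = I'.integralClosure) (hJ : J.integralClosure = J'.integralClosure) :
    (I * J).integralClosure = (I' * J').integralClosure :=
  le_antisymm
    (integralClosure_le_integralClosure <| (mul_mono (le_integralClosure.trans hI.le)
      (le_integralClosure.trans hJ.le)).trans integralClosure_mul_le)
    (integralClosure_le_integralClosure <| (mul_mono (le_integralClosure.trans hI.ge)
      (le_integralClosure.trans hJ.ge)).trans integralClosure_mul_le)

theorem integralClosure_pow_congr (h : I.integralClosure = J.integralClosure) (n : ℕ) :
    (I ^ n).integralClosure = (J ^ n).integralClosure := by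
  induction n with
  | zero => simp
  | succ n ih =>
    rw [pow_succ, pow_succ]
    exact integralClosure_mul_congr ih h

end Ideal

section Loj

variable {R : Type*} [CommRing R] [IsLocalRing R] {I J : Ideal R}

theorem mem_Lambda {x : ℝ} : x ∈ Lambda R I ↔ ∃ r s : ℕ, 0 < r ∧ 0 < s ∧
    maximalIdeal R ^ r ≤ (I ^ s).integralClosure ∧ x = (r : ℝ) / (s : ℝ) := Iff.rfl

theorem Loj_congr (h : I.integralClosure = J.integralClosure) : Loj R I = Loj R J := by
  unfold Loj
  congr 1
  ext x
  simp only [mem_Lambda, Ideal.integralClosure_pow_congr h]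

theorem Lambda_pow {n : ℕ} (hn : 0 < n) : Lambda R (I ^ n) = (n : ℝ) • Lambda R I := by
  have hn' : (n : ℝ) ≠ 0 := by positivity
  ext x
  rw [Set.mem_smul_set]
  constructor
  · rintro ⟨r, s, hr, hs, h, rfl⟩
    refine ⟨(r : ℝ) / (n * s : ℕ), ⟨r, n * s, hr, Nat.mul_pos hn hs, ?_, rfl⟩, ?_⟩
    · rwa [pow_mul]
    · rw [smul_eq_mul]
      push_cast
      field_simp
  · rintro ⟨_, ⟨r, s, hr, hs, h, rfl⟩, rfl⟩
    refine mem_Lambda.2 ⟨r * n, s, Nat.mul_pos hr hn, hs, ?_, ?_⟩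
    · rw [pow_mul, pow_right_comm I]
      exact (Ideal.pow_right_mono h n).trans (Ideal.integralClosure_pow_le n)
    · rw [smul_eq_mul]
      push_cast
      ring

theorem Loj_pow {n : ℕ} (hn : 0 < n) : Loj R (I ^ n) = n * Loj R I := by
  rw [Loj, Lambda_pow hn, Real.sInf_smul_of_nonneg n.cast_nonneg, smul_eq_mul, Loj]

end Loj

theorem loj_mul_of_projEquiv
    {R : Type*} [CommRing R] [IsNoetherianRing R] [IsLocalRing R]
    (I J : Ideal R) (hI : I ≠ ⊤) (hJ : J ≠ ⊤)
    (hIfin : (Lambda R I).Nonempty) (hJfin : (Lambda R J).Nonempty)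
    (h : ∃ a b : ℕ, 0 < a ∧ 0 < b ∧
      integralClosureIdeal (I ^ a) = integralClosureIdeal (J ^ b)) :
    Loj R (I * J) = Loj R I + Loj R J := by
  obtain ⟨a, b, ha, hb, h⟩ := h
  have hcl : (I ^ a).integralClosure = (J ^ b).integralClosure := SetLike.coe_injective h
  have hLoj : (a : ℝ) * Loj R I = b * Loj R J := by
    rw [← Loj_pow ha, ← Loj_pow hb, Loj_congr hcl]
  have hmul : ((I * J) ^ (a * b)).integralClosure = ((I ^ a) ^ (b + a)).integralClosure := by
    rw [mul_pow, pow_add, pow_mul, mul_comm a b, pow_mul J]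
    exact Ideal.integralClosure_mul_congr rfl (Ideal.integralClosure_pow_congr hcl.symm a)
  have key := Loj_congr hmul
  rw [Loj_pow (Nat.mul_pos ha hb), Loj_pow (Nat.add_pos_left hb a), Loj_pow ha] at key
  push_cast at key
  have ha' : (a : ℝ) ≠ 0 := by positivity
  have hb' : (b : ℝ) ≠ 0 := by positivity
  refine mul_left_cancel₀ (mul_ne_zero ha' hb') ?_
  linear_combination key + (a : ℝ) * hLoj
end
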